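/- Let the vertex set of an undirected graph be partitioned into two sets S and Y. Let ℋ = (H_1, …, H_m) be a family where each H_i is a set of pairwise vertex-disjoint S–S paths. If Σ_{i=1}^m |H_i| > 2|Y|, then there exists a strongly rainbow S–S path: an S–S path P such that each edge of P belongs to some path in some H_i, with distinct members H_i of ℋ used for distinct edges of P. -/

import Mathlib

/-- The (undirected) edges of a path given as a list of vertices: the unordered pairs of
consecutive vertices. -/
def uEdges {V : Type*} (l : List V) : List (Sym2 V) :=
  (l.zip l.tail).map fun p => s(p.1, p.2)

/-- `l` is an `S`–`S` path in `G`: a path (list of distinct vertices, consecutive ones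
adjacent) with at least one edge, whose two endpoints lie in `S` and all of whose other
vertices lie outside `S` (i.e. in `Y = V \ S`). -/
def IsSSPathList {V : Type*} (G : SimpleGraph V) (S : Set V) (l : List V) : Prop :=
  l.Nodup ∧ l.Chain' G.Adj ∧ 2 ≤ l.length ∧
  (∀ x ∈ l.head?, x ∈ S) ∧ (∀ x ∈ l.getLast?, x ∈ S) ∧
  ∀ v ∈ l, (∀ x ∈ l.head?, v ≠ x) → (∀ x ∈ l.getLast?, v ≠ x) → v ∉ S

theorem uEdges_cons2 {V : Type*} (a b : V) (l : List V) :
    uEdges (a :: b :: l) = s(a, b) :: uEdges (b :: l) := by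
  simp [uEdges]

theorem cross_aux {V : Type*} [DecidableEq V] (G : SimpleGraph V) (T : Finset V) :
    ∀ (l : List V) (x y : V), l.IsChain G.Adj → x ∈ l → x ∈ T → y ∈ l → y ∉ T →
      ∃ u ∈ T, ∃ w ∈ l, w ∉ T ∧ G.Adj u w ∧ s(u, w) ∈ uEdges l := by
  intro l
  induction l with
  | nil => intro x y _ hx; simp at hx
  | cons a l ih =>
    intro x y hc hx hxT hy hyT
    cases l with
    | nil =>
      simp at hx hy
      subst hx; subst hy
      exact absurd hxT hyT
    | cons b l =>
      rw [List.isChain_cons_cons] at hc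
      obtain ⟨hab, hc⟩ := hc
      have lift : (∃ u ∈ T, ∃ w ∈ b :: l, w ∉ T ∧ G.Adj u w ∧ s(u, w) ∈ uEdges (b :: l)) →
          ∃ u ∈ T, ∃ w ∈ a :: b :: l, w ∉ T ∧ G.Adj u w ∧ s(u, w) ∈ uEdges (a :: b :: l) := by
        rintro ⟨u, hu, w, hw, hwT, h1, h2⟩
        refine ⟨u, hu, w, List.mem_cons_of_mem _ hw, hwT, h1, ?_⟩
        rw [uEdges_cons2]
        exact List.mem_cons_of_mem _ h2
      by_cases ha : a ∈ T
      · by_cases hb : b ∈ T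
        · refine lift (ih b y hc (by simp) hb ?_ hyT)
          rcases List.mem_cons.1 hy with h | h
          · subst h; exact absurd ha hyT
          · exact h
        · exact ⟨a, ha, b, by simp, hb, hab, by simp [uEdges_cons2]⟩
      · by_cases hb : b ∈ T
        · exact ⟨b, hb, a, by simp, ha, hab.symm, by simp [uEdges_cons2, Sym2.eq_swap]⟩
        · refine lift (ih x b hc ?_ hxT (by simp) hb)
          rcases List.mem_cons.1 hx with h | h
          · subst h; exact absurd hxT ha
          · exact h

/-- `l` meets both `S ∩ A` and `S ∖ A`. -/
def SplitBy {V : Type*} (S A : Finset V) (l : List V) : Prop :=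
  (∃ x ∈ l, x ∈ S ∧ x ∈ A) ∧ ∃ y ∈ l, y ∈ S ∧ y ∉ A

open Classical in
theorem split_half {V : Type*} [Fintype V] (G : SimpleGraph V) (S : Finset V)
    (l : List V) (hl : IsSSPathList G (S : Set V) l) :
    Fintype.card (Finset V) ≤
      2 * (Finset.univ.filter fun A : Finset V => SplitBy S A l).card := by
  obtain ⟨hnd, -, hlen, hh, ht, -⟩ := hl
  obtain ⟨a, b, hab, ha, hb, haS, hbS⟩ : ∃ a b, a ≠ b ∧ a ∈ l ∧ b ∈ l ∧ a ∈ S ∧ b ∈ S := by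
    match l, hlen with
    | a :: c :: l, _ =>
      refine ⟨a, (c :: l).getLast (by simp), ?_, by simp, ?_, ?_, ?_⟩
      · intro h
        have := List.getLast_mem (l := c :: l) (by simp)
        rw [← h] at this
        exact (List.nodup_cons.1 hnd).1 this
      · exact List.mem_cons_of_mem _ (List.getLast_mem _)
      · simpa using hh a (by simp)
      · have := ht ((c :: l).getLast (by simp)) (by
          rw [List.getLast?_eq_getLast_of_ne_nil (by simp)]; simp)
        simpa using this
  have key : (Finset.univ.filter fun A : Finset V => ¬ SplitBy S A l).card ≤
      (Finset.univ.filter fun A : Finset V => SplitBy S A l).card := by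
    apply Finset.card_le_card_of_injOn (fun A => symmDiff A {a})
    · intro A hA
      simp only [Finset.coe_filter, Finset.mem_univ, true_and, Set.mem_setOf_eq] at hA ⊢
      have h1 : a ∈ A ↔ b ∈ A := by
        by_contra hne
        apply hA
        by_cases h : a ∈ A
        · exact ⟨⟨a, ha, haS, h⟩, b, hb, hbS, by tauto⟩
        · exact ⟨⟨b, hb, hbS, by tauto⟩, a, ha, haS, h⟩
      by_cases h : a ∈ A
      · exact ⟨⟨b, hb, hbS, by simp [Finset.mem_symmDiff, hab.symm, h1.1 h]⟩,
          a, ha, haS, by simp [Finset.mem_symmDiff, h]⟩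
      · have hb' : b ∉ A := fun h' => h (h1.2 h')
        exact ⟨⟨a, ha, haS, by simp [Finset.mem_symmDiff, h]⟩,
          b, hb, hbS, by simp [Finset.mem_symmDiff, hab.symm, hb']⟩
    · intro A _ B _ h
      exact symmDiff_left_injective _ h
  have := Finset.card_filter_add_card_filter_not (s := (Finset.univ : Finset (Finset V)))
    (fun A => SplitBy S A l)
  rw [Finset.card_univ] at this
  omega

/-- reachability certificate: reversed list from `v` back to `A` -/
def Cert {V : Type*} (G : SimpleGraph V) (S : Finset V) {m : ℕ}
    (H : Fin m → Finset (List V)) (T : Finset V) (I : Finset (Fin m)) (v : V) : Prop :=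
  ∃ (l : List V) (cs : List (Fin m)), (v :: l).Nodup ∧ (v :: l).IsChain G.Adj ∧
    (∀ x ∈ (v :: l), x ∈ T) ∧
    (∀ x ∈ (v :: l).getLast?, x ∈ S) ∧
    (∀ x ∈ (v :: l), x ∈ S → x ∈ (v :: l).getLast?) ∧
    cs.Nodup ∧ (∀ c ∈ cs, c ∈ I) ∧
    List.Forall₂ (fun e c => ∃ Q ∈ H c, e ∈ uEdges Q) (uEdges (v :: l)) cs

def Concl {V : Type*} (G : SimpleGraph V) (S : Finset V) {m : ℕ}
    (H : Fin m → Finset (List V)) : Prop :=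
  ∃ l : List V, IsSSPathList G (S : Set V) l ∧
      ∃ j : Fin (uEdges l).length → Fin m,
        Function.Injective j ∧
        ∀ t, ∃ Q ∈ H (j t), (uEdges l).get t ∈ uEdges Q

open Classical in
theorem grow {V : Type*} [Fintype V] [Nonempty V]
    (G : SimpleGraph V) (S : Finset V) (m : ℕ)
    (H : Fin m → Finset (List V))
    (hpaths : ∀ i, ∀ l ∈ H i, IsSSPathList G (S : Set V) l)
    (hdisj : ∀ i, ∀ l₁ ∈ H i, ∀ l₂ ∈ H i, l₁ ≠ l₂ → ∀ v ∈ l₁, v ∉ l₂)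
    (A : Finset V) (hno : ¬ Concl G S H) (I : Finset (Fin m)) :
    ∃ T : Finset V, S ∩ A ⊆ T ∧ T ⊆ (S ∩ A) ∪ Sᶜ ∧
      (S ∩ A).card + ∑ i ∈ I, ((H i).filter (SplitBy S A)).card ≤ T.card ∧
      ∀ v ∈ T, Cert G S H T I v := by
  induction I using Finset.induction_on with
  | empty =>
    refine ⟨S ∩ A, subset_rfl, Finset.subset_union_left, by simp, ?_⟩
    intro v hv
    have hv' := Finset.mem_inter.1 hv
    exact ⟨[], [], by simp, by simp, by simpa using hv', by simpa using hv'.1, by simp, by simp,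
      by simp, by simp [uEdges]⟩
  | insert i I hi ih =>
    obtain ⟨T, hAT, hTA, hcard, hT⟩ := ih
    have step : ∀ Q ∈ (H i).filter (SplitBy S A), ∃ w ∈ Q, w ∉ T ∧ ∃ u ∈ T, G.Adj u w ∧
        s(u, w) ∈ uEdges Q := by
      intro Q hQ
      obtain ⟨hQ, ⟨x, hx, hxS, hxA⟩, y, hy, hyS, hyA⟩ := Finset.mem_filter.1 hQ
      have hyT : y ∉ T := by
        intro h
        have := hTA h
        simp [hyA, hyS] at this
      obtain ⟨u, hu, w, hw, hwT, h1, h2⟩ := cross_aux G T Q x y (hpaths i Q hQ).2.1 hx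
        (hAT (Finset.mem_inter.2 ⟨hxS, hxA⟩)) hy hyT
      exact ⟨w, hw, hwT, u, hu, h1, h2⟩
    choose! f hfQ hfT u huT hadj hedge using step
    have hext : ∀ Q ∈ (H i).filter (SplitBy S A), f Q ∉ S ∧
        Cert G S H (T ∪ ((H i).filter (SplitBy S A)).image f) (insert i I) (f Q) := by
      intro Q hQ
      obtain ⟨l, cs, hnd, hch, hmem, hlast, hS, hcs, hcI, hF⟩ := hT _ (huT Q hQ)
      have hnotin : f Q ∉ (u Q :: l) := fun h => hfT Q hQ (hmem _ h)
      have hnd' : (f Q :: u Q :: l).Nodup := List.nodup_cons.2 ⟨hnotin, hnd⟩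
      have hch' : (f Q :: u Q :: l).IsChain G.Adj :=
        List.isChain_cons_cons.2 ⟨(hadj Q hQ).symm, hch⟩
      have hlastEq : (f Q :: u Q :: l).getLast? = (u Q :: l).getLast? := by
        simp [List.getLast?_cons_cons]
      have hcs' : (i :: cs).Nodup := List.nodup_cons.2 ⟨fun h => hi (hcI _ h), hcs⟩
      have hF' : List.Forall₂ (fun e c => ∃ Q ∈ H c, e ∈ uEdges Q)
          (uEdges (f Q :: u Q :: l)) (i :: cs) := by
        rw [uEdges_cons2]
        refine List.Forall₂.cons ⟨Q, (Finset.mem_filter.1 hQ).1, ?_⟩ hF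
        rw [Sym2.eq_swap]
        exact hedge Q hQ
      have hfS : f Q ∉ S := by
        intro hfS
        apply hno
        refine ⟨f Q :: u Q :: l, ⟨hnd', hch', by simp, ?_, ?_, ?_⟩, ?_⟩
        · intro x hx
          simp at hx
          subst hx
          simpa using hfS
        · rw [hlastEq]
          intro x hx
          simpa using hlast x hx
        · intro v hv h1 h2 hvS
          rw [hlastEq] at h2
          rcases List.mem_cons.1 hv with h | h
          · exact h1 (f Q) (by simp) h
          · exact h2 v (hS v h (by simpa using hvS)) rfl
        · have hlen := hF'.length_eq
          refine ⟨fun t => (i :: cs).get (Fin.cast hlen t), ?_, ?_⟩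
          · intro s t hst
            have := (List.nodup_iff_injective_get.1 hcs') hst
            exact Fin.cast_injective _ this
          · intro t
            exact (List.forall₂_iff_get.1 hF').2 t t.2 (hlen ▸ t.2)
      refine ⟨hfS, u Q :: l, i :: cs, hnd', hch', ?_, ?_, ?_, hcs', ?_, hF'⟩
      · intro x hx
        rcases List.mem_cons.1 hx with h | h
        · subst h
          exact Finset.mem_union_right _ (Finset.mem_image_of_mem _ hQ)
        · exact Finset.mem_union_left _ (hmem _ h)
      · rw [hlastEq]; exact hlast
      · rw [hlastEq]
        intro x hx hxS
        rcases List.mem_cons.1 hx with h | h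
        · subst h; exact absurd hxS hfS
        · exact hS x h hxS
      · intro c hc
        rcases List.mem_cons.1 hc with h | h
        · simp [h]
        · exact Finset.mem_insert_of_mem (hcI c h)
    refine ⟨T ∪ ((H i).filter (SplitBy S A)).image f, hAT.trans Finset.subset_union_left,
      Finset.union_subset hTA ?_, ?_, ?_⟩
    · intro w hw
      obtain ⟨Q, hQ, rfl⟩ := Finset.mem_image.1 hw
      exact Finset.mem_union_right _ (Finset.mem_compl.2 (hext Q hQ).1)
    · rw [Finset.card_union_of_disjoint, Finset.card_image_of_injOn, Finset.sum_insert hi]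
      · omega
      · intro Q hQ Q' hQ' h
        by_contra hne
        have h1 := (Finset.mem_filter.1 hQ).1
        have h2 := (Finset.mem_filter.1 hQ').1
        refine hdisj i Q h1 Q' h2 hne (f Q) (hfQ Q hQ) ?_
        have h' : f Q = f Q' := h
        rw [h']
        exact hfQ Q' hQ'
      · rw [Finset.disjoint_right]
        intro w hw
        obtain ⟨Q, hQ, rfl⟩ := Finset.mem_image.1 hw
        exact hfT Q hQ
    · intro v hv
      rcases Finset.mem_union.1 hv with hv | hv
      · obtain ⟨l, cs, hnd, hch, hmem, hlast, hS, hcs, hcI, hF⟩ := hT v hv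
        exact ⟨l, cs, hnd, hch, fun x hx => Finset.mem_union_left _ (hmem x hx), hlast, hS, hcs,
          fun c hc => Finset.mem_insert_of_mem (hcI c hc), hF⟩
      · obtain ⟨Q, hQ, rfl⟩ := Finset.mem_image.1 hv
        exact (hext Q hQ).2

open Classical in
theorem exists_split {V : Type*} [Fintype V]
    (G : SimpleGraph V) (S : Finset V) (m : ℕ)
    (H : Fin m → Finset (List V))
    (hpaths : ∀ i, ∀ l ∈ H i, IsSSPathList G (S : Set V) l) :
    ∃ A : Finset V, ∑ i, (H i).card ≤ 2 * ∑ i, ((H i).filter (SplitBy S A)).card := by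
  have h : ∑ A : Finset V, ∑ i, (H i).card ≤
      ∑ A : Finset V, 2 * ∑ i, ((H i).filter (SplitBy S A)).card := by
    rw [← Finset.mul_sum, Finset.sum_comm]
    rw [Finset.sum_comm (f := fun (A : Finset V) i => ((H i).filter (SplitBy S A)).card),
      Finset.mul_sum]
    refine Finset.sum_le_sum fun i _ => ?_
    simp only [Finset.card_filter]
    rw [Finset.sum_comm, Finset.mul_sum, Finset.sum_const, smul_eq_mul, mul_comm,
      ← smul_eq_mul, ← Finset.sum_const]
    refine Finset.sum_le_sum fun l hl => ?_
    rw [← Finset.card_filter]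
    exact split_half G S l (hpaths i l hl)
  obtain ⟨A, -, hA⟩ := Finset.exists_le_of_sum_le Finset.univ_nonempty h
  exact ⟨A, hA⟩

open Classical in
theorem final_aux {V : Type*} [Fintype V]
    (G : SimpleGraph V) (S : Finset V) (m : ℕ)
    (H : Fin m → Finset (List V))
    (hpaths : ∀ i, ∀ l ∈ H i, IsSSPathList G (S : Set V) l)
    (hdisj : ∀ i, ∀ l₁ ∈ H i, ∀ l₂ ∈ H i, l₁ ≠ l₂ → ∀ v ∈ l₁, v ∉ l₂)
    (hsum : 2 * (Fintype.card V - S.card) < ∑ i, (H i).card) : Concl G S H := by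
  by_contra hno
  have hV : Nonempty V := by
    by_contra hV
    rw [not_nonempty_iff] at hV
    have h0 : ∑ i, (H i).card = 0 := by
      refine Finset.sum_eq_zero fun i _ => ?_
      rw [Finset.card_eq_zero, Finset.eq_empty_iff_forall_notMem]
      intro l hl
      have h2 := (hpaths i l hl).2.2.1
      cases l with
      | nil => simp at h2
      | cons a l => exact hV.elim a
    omega
  obtain ⟨A, hA⟩ := exists_split G S m H hpaths
  obtain ⟨T, -, hTA, hcard, -⟩ := grow G S m H hpaths hdisj A hno Finset.univ
  have h1 := (Finset.card_le_card hTA).trans (Finset.card_union_le _ _)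
  rw [Finset.card_compl] at h1
  omega

/-- If the vertex set of a graph is partitioned into `S` and `Y = Sᶜ`,
`H₁, …, Hₘ` are sets of pairwise vertex-disjoint `S`–`S` paths, and `Σ |Hᵢ| > 2|Y|`, then
there is a strongly rainbow `S`–`S` path: each of its edges belongs to a path of some
`Hᵢ`, distinct members `Hᵢ` being used for distinct edges. -/
theorem stmt_4 {V : Type*} [Fintype V] [DecidableEq V]
    (G : SimpleGraph V) (S : Finset V) (m : ℕ)
    (H : Fin m → Finset (List V))
    (hpaths : ∀ i, ∀ l ∈ H i, IsSSPathList G (S : Set V) l)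
    (hdisj : ∀ i, ∀ l₁ ∈ H i, ∀ l₂ ∈ H i, l₁ ≠ l₂ → ∀ v ∈ l₁, v ∉ l₂)
    (hsum : 2 * Sᶜ.card < ∑ i, (H i).card) :
    ∃ l : List V, IsSSPathList G (S : Set V) l ∧
      ∃ j : Fin (uEdges l).length → Fin m,
        Function.Injective j ∧
        ∀ t, ∃ Q ∈ H (j t), (uEdges l).get t ∈ uEdges Q := by
  rw [Finset.card_compl] at hsum
  exact final_aux G S m H hpaths hdisj hsum
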